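/- Let g ∈ S₀(ℝⁿ) and 1 ≤ q < ∞. Then ∫₀^∞ g*(t) t^{1/q − 1} dt ≤ 2^{1 + 1/q} q ∫₀^∞ [g*(t) − g*(2t)] t^{1/q − 1} dt. -/

import Mathlib

open MeasureTheory Set
open scoped ENNReal

noncomputable section

/-- Extended essential sup norm on ℝ. -/
def einf (φ : ℝ → ℝ) : ℝ≥0∞ := eLpNorm φ ⊤ volume

/-- Lipschitz `α` seminorm (extended real valued):
`sup_{h>0} h^{-α} ‖φ(·+h) - φ‖_∞`. -/
def lipSemiE (α : ℝ) (φ : ℝ → ℝ) : ℝ≥0∞ :=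
  ⨆ h ∈ Ioi (0:ℝ), ENNReal.ofReal (h ^ (-α)) * einf (fun x => φ (x + h) - φ x)

/-- Real-valued Lipschitz `α` seminorm `‖φ‖*_{Lip α}`. -/
def lipSemi (α : ℝ) (φ : ℝ → ℝ) : ℝ := (lipSemiE α φ).toReal

/-- `φ ∈ Lip α`: essentially bounded with finite Lipschitz `α` seminorm. -/
def MemLip (α : ℝ) (φ : ℝ → ℝ) : Prop := einf φ < ⊤ ∧ lipSemiE α φ < ⊤

/-- `‖φ‖_{Lip α} = ‖φ‖_∞ + ‖φ‖*_{Lip α}`. -/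
def lipNorm (α : ℝ) (φ : ℝ → ℝ) : ℝ := (einf φ + lipSemiE α φ).toReal

/-- The class `S₀`: measurable functions with finite distribution function at every
positive level. -/
def S0 {X : Type*} [MeasureSpace X] (f : X → ℝ) : Prop :=
  Measurable f ∧ ∀ s : ℝ, 0 < s → volume {x | s < |f x|} < ⊤

/-- The non-increasing rearrangement `f*`. -/
def rearr {X : Type*} [MeasureSpace X] (f : X → ℝ) (t : ℝ) : ℝ :=
  sInf {s : ℝ | 0 ≤ s ∧ volume {x | s < |f x|} ≤ ENNReal.ofReal t}

/-- `f**(t) = (1/t) ∫₀^t f*(u) du`. -/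
def doubleStar {X : Type*} [MeasureSpace X] (f : X → ℝ) (t : ℝ) : ℝ :=
  (∫ u in Ioc (0:ℝ) t, rearr f u) / t

/-- Lorentz `L^{p,q}` norm. -/
def lorentzNorm {X : Type*} [MeasureSpace X] (p q : ℝ) (f : X → ℝ) : ℝ :=
  (∫ t in Ioi (0:ℝ), (t ^ (1/p) * rearr f t) ^ q / t) ^ (1/q)

/-- Membership in the Lorentz space `L^{p,q}`. -/
def MemLorentz {X : Type*} [MeasureSpace X] (p q : ℝ) (f : X → ℝ) : Prop :=
  S0 f ∧ IntegrableOn (fun t => (t ^ (1/p) * rearr f t) ^ q / t) (Ioi (0:ℝ))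

/-- The space `U_p(ℝ²)`: a.e. sections in `Lip (1/p)`, with `Lip (1/p)` norms of the
sections in `L^{p,1}(ℝ)`. -/
def MemUp (p : ℝ) (f : ℝ × ℝ → ℝ) : Prop :=
  Measurable f ∧
  (∀ᵐ y : ℝ ∂volume, MemLip (1/p) (fun x => f (x, y))) ∧
  (∀ᵐ x : ℝ ∂volume, MemLip (1/p) (fun y => f (x, y))) ∧
  MemLorentz p 1 (fun y => lipNorm (1/p) (fun x => f (x, y))) ∧
  MemLorentz p 1 (fun x => lipNorm (1/p) (fun y => f (x, y)))

/-- The Steklov-type average `f_h`. -/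
def avg (f : ℝ × ℝ → ℝ) (h : ℝ) (z : ℝ × ℝ) : ℝ :=
  (∫ u in Ioc (0:ℝ) h, ∫ v in Ioc (0:ℝ) h, f (z.1 + u, z.2 + v)) / h ^ 2

section rearrangement

variable {X : Type*} [MeasureSpace X]

lemma rearr_nonneg (f : X → ℝ) (t : ℝ) : 0 ≤ rearr f t :=
  Real.sInf_nonneg fun _ hs => hs.1

lemma rearr_le {f : X → ℝ} {s t : ℝ} (hs : 0 ≤ s)
    (h : volume {x | s < |f x|} ≤ ENNReal.ofReal t) : rearr f t ≤ s :=
  csInf_le ⟨0, fun _ hr => hr.1⟩ ⟨hs, h⟩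

lemma S0.exists_level {f : X → ℝ} (hf : S0 f) {t : ℝ} (ht : 0 < t) :
    ∃ s : ℝ, 0 ≤ s ∧ volume {x | s < |f x|} ≤ ENNReal.ofReal t := by
  have hlim : Filter.Tendsto (fun k : ℕ => volume {x | (k : ℝ) + 1 < |f x|})
      Filter.atTop (nhds 0) := by
    have hempty : ⋂ k : ℕ, {x | (k : ℝ) + 1 < |f x|} = ∅ := by
      ext x
      simp only [mem_iInter, mem_ofPred_eq, mem_empty_iff_false, iff_false, not_forall, not_lt]
      obtain ⟨k, hk⟩ := exists_nat_ge |f x|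
      exact ⟨k, by linarith⟩
    rw [← measure_empty (μ := (volume : Measure X)), ← hempty]
    refine tendsto_measure_iInter_atTop (fun k => ?_) (fun k l hkl x hx => ?_) ⟨0, ?_⟩
    · exact (measurableSet_lt measurable_const hf.1.abs).nullMeasurableSet
    · have : (k : ℝ) ≤ l := by exact_mod_cast hkl
      simp only [mem_ofPred_eq] at hx ⊢
      linarith
    · exact (hf.2 _ (by positivity)).ne
  obtain ⟨k, hk⟩ := (hlim.eventually_le_const (ENNReal.ofReal_pos.2 ht)).exists
  exact ⟨k + 1, by positivity, hk⟩

lemma S0.antitoneOn_rearr {f : X → ℝ} (hf : S0 f) : AntitoneOn (rearr f) (Ioi 0) :=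
  fun _ ht _ _ htu => csInf_le_csInf ⟨0, fun _ hr => hr.1⟩ (hf.exists_level ht)
    fun _ hs => ⟨hs.1, hs.2.trans (ENNReal.ofReal_le_ofReal htu)⟩

lemma S0.tendsto_rearr {f : X → ℝ} (hf : S0 f) :
    Filter.Tendsto (rearr f) Filter.atTop (nhds 0) := by
  refine Metric.tendsto_atTop.2 fun ε hε => ?_
  refine ⟨(volume {x | ε / 2 < |f x|}).toReal, fun t ht => ?_⟩
  have h : rearr f t ≤ ε / 2 := rearr_le (by positivity)
    ((ENNReal.le_ofReal_iff_toReal_le (hf.2 _ (by positivity)).ne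
      (ENNReal.toReal_nonneg.trans ht)).2 ht)
  rw [Real.dist_eq, sub_zero, abs_of_nonneg (rearr_nonneg f t)]
  linarith

end rearrangement

lemma lintegral_Ioi_comp_mul_left (G : ℝ → ℝ≥0∞) {c : ℝ} (hc : 0 < c) :
    ∫⁻ t in Ioi (0:ℝ), G (c * t) = ENNReal.ofReal c⁻¹ * ∫⁻ t in Ioi (0:ℝ), G t := by
  have himage : (fun t : ℝ => c * t) '' Ioi 0 = Ioi 0 := by
    simpa using image_mul_left_Ioi hc 0
  have h := lintegral_image_eq_lintegral_abs_deriv_mul (s := Ioi (0:ℝ)) (f := fun t => c * t)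
    (f' := fun _ => c) measurableSet_Ioi
    (fun t _ => by simpa using ((hasDerivAt_id t).const_mul c).hasDerivWithinAt)
    (fun _ _ _ _ h => mul_left_cancel₀ hc.ne' h) G
  rw [himage, lintegral_const_mul' _ _ ENNReal.ofReal_ne_top, abs_of_pos hc] at h
  rw [h, ← mul_assoc, ← ENNReal.ofReal_mul (by positivity), inv_mul_cancel₀ hc.ne',
    ENNReal.ofReal_one, one_mul]

/-- Telescoping along dyadic dilations. -/
lemma lintegral_rpow_eq_dyadic_difference {F : ℝ → ℝ} (hF : AntitoneOn F (Ioi 0))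
    (hlim : Filter.Tendsto F Filter.atTop (nhds 0)) (a : ℝ) :
    ∫⁻ t in Ioi (0:ℝ), ENNReal.ofReal (F t * t ^ (a - 1)) =
      (1 - ENNReal.ofReal ((2:ℝ) ^ (-a)))⁻¹ *
        ∫⁻ t in Ioi (0:ℝ), ENNReal.ofReal ((F t - F (2 * t)) * t ^ (a - 1)) := by
  set G : ℝ → ℝ≥0∞ := fun t => ENNReal.ofReal ((F t - F (2 * t)) * t ^ (a - 1)) with hG
  have hGm : ∀ k : ℕ, AEMeasurable (fun t => G (2 ^ k * t)) (volume.restrict (Ioi 0)) := by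
    intro k
    have hdil : ∀ c : ℝ, 0 < c →
        AEMeasurable (fun t => F (c * t)) (volume.restrict (Ioi 0)) := fun c hc =>
      aemeasurable_restrict_of_antitoneOn measurableSet_Ioi fun t ht u hu htu =>
        hF (mul_pos hc ht) (mul_pos hc hu) (mul_le_mul_of_nonneg_left htu hc.le)
    have h2 := hdil (2 * 2 ^ k) (by positivity)
    simp only [mul_assoc] at h2
    exact (((hdil _ (by positivity)).sub h2).mul (by fun_prop)).ennreal_ofReal
  have htele : ∀ t ∈ Ioi (0:ℝ), ENNReal.ofReal (F t * t ^ (a - 1)) =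
      ∑' k : ℕ, ENNReal.ofReal (((2:ℝ) ^ k) ^ (1 - a)) * G (2 ^ k * t) := by
    intro t ht
    have ht : 0 < t := ht
    have hterm : ∀ k : ℕ, ENNReal.ofReal (((2:ℝ) ^ k) ^ (1 - a)) * G (2 ^ k * t) =
        ENNReal.ofReal ((F (2 ^ k * t) - F (2 ^ (k + 1) * t)) * t ^ (a - 1)) := by
      intro k
      have hk : (0:ℝ) < 2 ^ k := by positivity
      have hone : ((2:ℝ) ^ k) ^ (1 - a) * (2 ^ k) ^ (a - 1) = 1 := by
        rw [← Real.rpow_add hk]; simp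
      rw [hG, ← ENNReal.ofReal_mul (by positivity), Real.mul_rpow hk.le ht.le, pow_succ',
        mul_assoc 2]
      congr 1
      linear_combination (F (2 ^ k * t) - F (2 * (2 ^ k * t))) * t ^ (a - 1) * hone
    have hnonneg : ∀ k : ℕ, 0 ≤ (F (2 ^ k * t) - F (2 ^ (k + 1) * t)) * t ^ (a - 1) := by
      intro k
      refine mul_nonneg (sub_nonneg.2 (hF ?_ ?_ ?_)) (by positivity)
      · exact mem_Ioi.2 (by positivity)
      · exact mem_Ioi.2 (by positivity)
      · gcongr <;> simp
    have hsum : HasSum (fun k : ℕ => (F (2 ^ k * t) - F (2 ^ (k + 1) * t)) * t ^ (a - 1))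
        (F t * t ^ (a - 1)) := by
      rw [hasSum_iff_tendsto_nat_of_nonneg hnonneg]
      simp only [← Finset.sum_mul, Finset.sum_range_sub' (fun k : ℕ => F (2 ^ k * t))]
      have hF0 : Filter.Tendsto (fun k : ℕ => F (2 ^ k * t)) Filter.atTop (nhds 0) :=
        hlim.comp ((tendsto_pow_atTop_atTop_of_one_lt one_lt_two).atTop_mul_const ht)
      simpa using (hF0.const_sub (F t)).mul_const (t ^ (a - 1))
    simp only [hterm]
    rw [← hsum.tsum_eq, ENNReal.ofReal_tsum_of_nonneg hnonneg hsum.summable]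
  rw [setLIntegral_congr_fun measurableSet_Ioi htele,
    lintegral_tsum fun k => (hGm k).const_mul _, ← ENNReal.tsum_geometric, ← ENNReal.tsum_mul_right]
  refine tsum_congr fun k => ?_
  have hk : (0:ℝ) < 2 ^ k := by positivity
  rw [lintegral_const_mul' _ _ ENNReal.ofReal_ne_top, lintegral_Ioi_comp_mul_left G hk,
    ← mul_assoc, ← ENNReal.ofReal_mul (by positivity), ← ENNReal.ofReal_pow (by positivity)]
  congr 2
  rw [← Real.rpow_neg_one, ← Real.rpow_add hk, ← Real.rpow_natCast, ← Real.rpow_natCast,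
    ← Real.rpow_mul zero_le_two, ← Real.rpow_mul zero_le_two]
  congr 1
  ring

lemma inv_one_sub_two_rpow_neg_le {a : ℝ} (ha : 0 < a) :
    (1 - ENNReal.ofReal ((2:ℝ) ^ (-a)))⁻¹ ≤ ENNReal.ofReal ((2:ℝ) ^ (1 + a) * a⁻¹) := by
  have hexp : 1 + a / 2 ≤ (2:ℝ) ^ a := by
    rw [Real.rpow_def_of_pos two_pos]
    nlinarith [Real.add_one_le_exp (Real.log 2 * a), Real.log_two_gt_d9]
  have hpos : (0:ℝ) < 2 ^ a := by positivity
  have hlt : (2:ℝ) ^ (-a) < 1 := Real.rpow_lt_one_of_one_lt_of_neg one_lt_two (by linarith)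
  rw [← ENNReal.ofReal_one, ← ENNReal.ofReal_sub _ (by positivity),
    ← ENNReal.ofReal_inv_of_pos (by linarith)]
  refine ENNReal.ofReal_le_ofReal ?_
  rw [inv_le_iff_one_le_mul₀ (by linarith), Real.rpow_add two_pos, Real.rpow_one,
    Real.rpow_neg zero_le_two]
  have : (2 * (2:ℝ) ^ a * a⁻¹) * (1 - ((2:ℝ) ^ a)⁻¹) = 2 * (2 ^ a - 1) / a := by
    field_simp
  rw [this, le_div_iff₀ ha]
  linarith

/-- For `g ∈ S₀(ℝⁿ)` and `1 ≤ q < ∞`,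
`∫₀^∞ g*(t) t^{1/q-1} dt ≤ 2^{1+1/q} q ∫₀^∞ [g*(t) - g*(2t)] t^{1/q-1} dt`. -/
theorem stmt4 (n : ℕ) (g : (Fin n → ℝ) → ℝ) (hg : S0 g) (q : ℝ) (hq : 1 ≤ q) :
    ∫⁻ t in Ioi (0:ℝ), ENNReal.ofReal (rearr g t * t ^ (1/q - 1)) ≤
      ENNReal.ofReal ((2:ℝ) ^ (1 + 1/q) * q) *
        ∫⁻ t in Ioi (0:ℝ), ENNReal.ofReal ((rearr g t - rearr g (2*t)) * t ^ (1/q - 1)) := by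
  rw [lintegral_rpow_eq_dyadic_difference hg.antitoneOn_rearr hg.tendsto_rearr]
  gcongr
  simpa using inv_one_sub_two_rpow_neg_le (a := 1 / q) (by positivity)

end
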